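/- For all Γ̂ ∈ [0, 0.49] and δ ∈ [0, δ_max]: (5/4)·|B(Γ̂;δ)| ≤ 1 ≤ A(Γ̂;δ), where A(Γ̂;δ) = (1+2Γ̂)·(1 + δ·U00/2) and B(Γ̂;δ) = (2δ/3)·U10·(1 − 4Γ̂ − 4Γ̂²)/√((1−2Γ̂)(3+2Γ̂)). -/

import Mathlib

noncomputable section
open Real Set

namespace Secular

def U00 : ℝ := 0.762646
def U10 : ℝ := 0.547442
def U20 : ℝ := 0.237353
def mC : ℝ := (-4 + Real.sqrt 21) / 5
def rhoC : ℝ := 1.762157978551987e-18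
def muC : ℝ := 398600.44
def aM : ℝ := 384400
def aMin : ℝ := 6378.14
def aMax : ℝ := 30000
def Lmin : ℝ := Real.sqrt (muC * aMin)
def Lmax : ℝ := Real.sqrt (muC * aMax)
def deltaFun (L : ℝ) : ℝ := rhoC * L ^ 10 / (muC ^ 3 * aM ^ 3)
def deltaMax : ℝ := deltaFun Lmax
def rho0 : ℝ := muC ^ 4 * 1.08e-3 * 6378.14 ^ 2
def rho1 : ℝ := rhoC * rho0
def alphaCube (L : ℝ) : ℝ := L ^ 6 / (muC ^ 3 * aM ^ 3)

def aA (σ : ℝ) : ℝ := 1 - 16 * σ - 20 * σ ^ 2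
def bB (σ : ℝ) : ℝ := (2 * σ + 3) * Real.sqrt (3 - 4 * σ - 4 * σ ^ 2)
def cPl (σ : ℝ) : ℝ := U00 / 2 * aA σ + 5 * U10 / 3 * bB σ
def cMi (σ : ℝ) : ℝ := U00 / 2 * aA σ - 5 * U10 / 3 * bB σ
def Ap (σ δ : ℝ) : ℝ := aA σ + δ * cPl σ
def Am (σ δ : ℝ) : ℝ := aA σ + δ * cMi σ


def Afun (Γh δ : ℝ) : ℝ := (1 + 2*Γh) * (1 + δ * U00 / 2)
def Bfun (Γh δ : ℝ) : ℝ :=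
  (2*δ/3) * U10 * (1 - 4*Γh - 4*Γh^2) / Real.sqrt ((1 - 2*Γh) * (3 + 2*Γh))
def Cfun (Γh δ : ℝ) : ℝ := -(δ/6) * U20 * (1 + 2*Γh)

theorem deltaMax_le : deltaMax ≤ 0.12 := by
  have h : Lmax ^ 10 = (muC * aMax) ^ 5 := by
    have hsq : Lmax ^ 2 = muC * aMax := Real.sq_sqrt (by norm_num [muC, aMax])
    rw [← hsq, ← pow_mul]
  rw [deltaMax, deltaFun, h]
  norm_num [rhoC, muC, aMax, aM]

theorem quarter_le_sqrt {x : ℝ} (hx : x ∈ Set.Icc (0:ℝ) 0.49) :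
    1 / 4 ≤ Real.sqrt ((1 - 2*x) * (3 + 2*x)) := by
  obtain ⟨h0, h1⟩ := hx
  norm_num at h1
  apply Real.le_sqrt_of_sq_le
  nlinarith

theorem abs_numerator_le {x : ℝ} (hx : x ∈ Set.Icc (0:ℝ) 0.49) :
    |1 - 4*x - 4*x^2| ≤ 2 := by
  obtain ⟨h0, h1⟩ := hx
  norm_num at h1
  rw [abs_le]
  constructor <;> nlinarith

/-- for all `Γ̂ ∈ [0,0.49]` and `δ ∈ [0,δ_max]`,
`(5/4)·|B(Γ̂;δ)| ≤ 1 ≤ A(Γ̂;δ)`. -/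
theorem stmt9 :
    ∀ Γh ∈ Set.Icc (0:ℝ) 0.49, ∀ δ ∈ Set.Icc (0:ℝ) deltaMax,
      (5/4) * |Bfun Γh δ| ≤ 1 ∧ 1 ≤ Afun Γh δ := by
  intro x hx δ hδ
  have hd : δ ≤ 0.12 := hδ.2.trans deltaMax_le
  have hδ0 : 0 ≤ δ := hδ.1
  have hs := quarter_le_sqrt hx
  have hn := abs_numerator_le hx
  have hx0 : 0 ≤ x := hx.1
  norm_num at hd
  constructor
  · have hU : (0:ℝ) ≤ U10 := by norm_num [U10]
    have hc : 2*δ/3 * U10 ≤ 0.05 := by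
      norm_num [U10]
      linarith
    have hprod : 2*δ/3 * U10 * |1 - 4*x - 4*x^2| ≤ 0.05 * 2 :=
      mul_le_mul hc hn (abs_nonneg _) (by norm_num)
    rw [Bfun, abs_div, abs_mul, abs_of_nonneg (show 0 ≤ 2*δ/3 * U10 by positivity),
      abs_of_nonneg (Real.sqrt_nonneg _), ← mul_div_assoc, div_le_one (by linarith)]
    norm_num at hprod
    linarith
  · have hU : (0:ℝ) ≤ U00 := by norm_num [U00]
    have h : 0 ≤ δ * U00 / 2 := by positivity
    rw [Afun]
    nlinarith [mul_nonneg hx0 h]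

end Secular
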